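/- arXiv:2007.08518 — 2 statements merged into one kernel-verified Lean document; each statement's English description precedes it below -/
import Mathlib

section
/- Let G_n be the (finite) set of all distinct n-player binary games with payoffs in {0,1} (i.e., all assignments of a payoff in {0,1} to each pair (player, strategy profile)). For ε > 0 let G̃_{n,ε} be the subset of games Γ_n ∈ G_n such that WEq(Γ_n) ∈ [x_weq(1/2) − ε, x_weq(1/2) + ε] and SO(Γ_n), BEq(Γ_n) ∈ [1−ε, 1], where x_weq(1/2) = inf{x ∈ [0,1] : H_{2/3}(x) = log(3/2)}. Then for every ε > 0, |G̃_{n,ε}| / |G_n| → 1 as n → ∞. -/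
open Set Filter Topology

noncomputable section

/-- Flip player `i`'s strategy in profile `σ`. -/
def flipStrat {n : ℕ} (σ : Fin n → Bool) (i : Fin n) : Fin n → Bool :=
  Function.update σ i (!(σ i))

/-- The real payoff of player `i` at profile `σ` in a binary-payoff game `Γ`. -/
def pay {n : ℕ} (Γ : Fin n → (Fin n → Bool) → Bool) (i : Fin n) (σ : Fin n → Bool) : ℝ :=
  if Γ i σ then 1 else 0

/-- `σ` is a pure Nash equilibrium of the binary-payoff game `Γ`. -/
def isPNEb {n : ℕ} (Γ : Fin n → (Fin n → Bool) → Bool) (σ : Fin n → Bool) : Prop :=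
  ∀ i : Fin n, pay Γ i (flipStrat σ i) ≤ pay Γ i σ

/-- Average social utility of profile `σ` in the binary-payoff game `Γ`. -/
def ASUb {n : ℕ} (Γ : Fin n → (Fin n → Bool) → Bool) (σ : Fin n → Bool) : ℝ :=
  (1 / (n : ℝ)) * ∑ i : Fin n, pay Γ i σ

/-- Social optimum of the binary-payoff game `Γ`. -/
def SOb {n : ℕ} (Γ : Fin n → (Fin n → Bool) → Bool) : ℝ :=
  ⨆ σ : Fin n → Bool, ASUb Γ σ

/-- Best-equilibrium average social utility of `Γ`. -/
def BEqb {n : ℕ} (Γ : Fin n → (Fin n → Bool) → Bool) : ℝ :=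
  sSup (ASUb Γ '' {σ : Fin n → Bool | isPNEb Γ σ})

/-- Worst-equilibrium average social utility of `Γ`. -/
def WEqb {n : ℕ} (Γ : Fin n → (Fin n → Bool) → Bool) : ℝ :=
  sInf (ASUb Γ '' {σ : Fin n → Bool | isPNEb Γ σ})

/-- The entropy function `H_q(x)`. -/
def entH (q x : ℝ) : ℝ :=
  x * Real.log (x / q) + (1 - x) * Real.log ((1 - x) / (1 - q))

/-- `x_weq(1/2) = inf {x ∈ [0,1] : H_{2/3}(x) = log(3/2)}`. -/
def xweqHalf : ℝ :=
  sInf {x : ℝ | x ∈ Icc (0:ℝ) 1 ∧ entH (2/3) x = Real.log (3/2)}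

/-! ### The exponential growth rate -/

/-- Exponential growth rate of the expected number of equilibria with average utility `x`. -/
def growthRate (x : ℝ) : ℝ := Real.binEntropy x - (1 - x) * Real.log 2

lemma continuous_growthRate : Continuous growthRate := by
  unfold growthRate
  have := Real.binEntropy_continuous
  fun_prop

lemma entH_eq_sub_growthRate {x : ℝ} (hx : x ∈ Icc (0:ℝ) 1) :
    entH (2/3) x = Real.log (3/2) - growthRate x := by
  have h3 : Real.log (3/2) = Real.log 3 - Real.log 2 := Real.log_div (by norm_num) (by norm_num)
  have hleft : x * Real.log (x / (2/3)) = x * (Real.log x - (Real.log 2 - Real.log 3)) := by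
    rcases eq_or_ne x 0 with rfl | h
    · simp
    · rw [Real.log_div h (by norm_num), Real.log_div (by norm_num) (by norm_num)]
  have hright : (1 - x) * Real.log ((1 - x) / (1 - 2/3)) =
      (1 - x) * (Real.log (1 - x) + Real.log 3) := by
    rcases eq_or_ne (1 - x) 0 with h | h
    · simp [h]
    · rw [Real.log_div h (by norm_num), show (1 - 2/3 : ℝ) = 3⁻¹ by norm_num, Real.log_inv]
      ring
  rw [entH, hleft, hright, h3, growthRate, Real.binEntropy, Real.log_inv, Real.log_inv]
  ring

lemma xweqHalf_eq : xweqHalf = sInf {x : ℝ | x ∈ Icc (0:ℝ) 1 ∧ growthRate x = 0} := by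
  unfold xweqHalf
  congr 1
  ext x
  simp only [mem_ofPred_eq]
  refine and_congr_right fun hx => ?_
  rw [entH_eq_sub_growthRate hx]
  constructor <;> intro h <;> linarith

lemma growthRate_zero : growthRate 0 = - Real.log 2 := by simp [growthRate]

lemma growthRate_one : growthRate 1 = 0 := by simp [growthRate]

lemma growthRate_two_thirds_pos : 0 < growthRate (2/3) := by
  have h : growthRate (2/3) = Real.log (3/2) := by
    rw [growthRate, Real.binEntropy, show (2/3 : ℝ)⁻¹ = 3/2 by norm_num,
      show (1 - 2/3 : ℝ)⁻¹ = 3 by norm_num, Real.log_div (by norm_num) (by norm_num)]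
    ring
  rw [h]
  exact Real.log_pos (by norm_num)

lemma bddBelow_growthRate_zeros : BddBelow {x : ℝ | x ∈ Icc (0:ℝ) 1 ∧ growthRate x = 0} :=
  ⟨0, fun _ hx => hx.1.1⟩

lemma xweqHalf_mem : xweqHalf ∈ Icc (0:ℝ) 1 ∧ growthRate xweqHalf = 0 := by
  rw [xweqHalf_eq]
  have hc : IsClosed {x : ℝ | x ∈ Icc (0:ℝ) 1 ∧ growthRate x = 0} :=
    isClosed_Icc.inter (isClosed_eq continuous_growthRate continuous_const)
  exact hc.csInf_mem ⟨1, ⟨by simp, growthRate_one⟩⟩ bddBelow_growthRate_zeros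

lemma growthRate_neg_of_lt_xweqHalf {x : ℝ} (hx0 : 0 ≤ x) (hx : x < xweqHalf) :
    growthRate x < 0 := by
  by_contra! h
  have h0 : growthRate 0 ≤ 0 := by
    rw [growthRate_zero]
    have := Real.log_pos (one_lt_two)
    linarith
  obtain ⟨y, hy, hy0⟩ := intermediate_value_Icc hx0 continuous_growthRate.continuousOn ⟨h0, h⟩
  have : xweqHalf ≤ y := by
    rw [xweqHalf_eq]
    exact csInf_le bddBelow_growthRate_zeros
      ⟨⟨hy.1, hy.2.trans (hx.le.trans xweqHalf_mem.1.2)⟩, hy0⟩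
  linarith [hy.2]

lemma xweqHalf_lt_one : xweqHalf < 1 := by
  by_contra! h
  have := growthRate_neg_of_lt_xweqHalf (x := 2/3) (by norm_num) (by linarith)
  linarith [growthRate_two_thirds_pos]

lemma growthRate_pos {x : ℝ} (hx : xweqHalf < x) (hx1 : x < 1) : 0 < growthRate x := by
  have hconc : StrictConcaveOn ℝ (Icc 0 1) growthRate := by
    have hlin : ConcaveOn ℝ (Icc (0:ℝ) 1) fun x : ℝ => -((1 - x) * Real.log 2) := by
      refine ⟨convex_Icc 0 1, fun a _ b _ s t _ _ hst => le_of_eq ?_⟩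
      simp only [smul_eq_mul]
      linear_combination (Real.log 2) * (-hst)
    have hsum : growthRate = Real.binEntropy + fun x : ℝ => -((1 - x) * Real.log 2) := by
      funext x
      exact sub_eq_add_neg _ _
    rw [hsum]
    exact Real.strictConcave_binEntropy.add_concaveOn hlin
  have hmem := xweqHalf_mem
  have hL : 0 < 1 - xweqHalf := sub_pos.2 xweqHalf_lt_one
  have h := hconc.2 hmem.1 (right_mem_Icc.2 zero_le_one) xweqHalf_lt_one.ne
    (div_pos (sub_pos.2 hx1) hL) (div_pos (sub_pos.2 hx) hL) (by field_simp; ring)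
  simp only [smul_eq_mul, hmem.2, growthRate_one, mul_zero, add_zero] at h
  have hx_eq : (1 - x) / (1 - xweqHalf) * xweqHalf + (x - xweqHalf) / (1 - xweqHalf) * 1 = x := by
    field_simp
    ring
  rwa [hx_eq] at h

/-! ### Binomial coefficients -/

lemma choose_mul_pow_le (n k : ℕ) (hk : k ≤ n) :
    n.choose k * (k ^ k * (n - k) ^ (n - k)) ≤ n ^ n := by
  have h := add_pow k (n - k) n
  rw [Nat.add_sub_cancel' hk] at h
  rw [h]
  calc _ = k ^ k * (n - k) ^ (n - k) * n.choose k := by ring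
    _ ≤ _ := Finset.single_le_sum (f := fun m => k ^ m * (n - k) ^ (n - m) * n.choose m)
      (fun _ _ => Nat.zero_le _) (Finset.mem_range.2 (by omega))

lemma binomial_term_le_mode (n k : ℕ) (hk : k ≤ n) (j : ℕ) (hj : j ≤ n) :
    k ^ j * (n - k) ^ (n - j) * n.choose j ≤ k ^ k * (n - k) ^ (n - k) * n.choose k := by
  obtain ⟨m, rfl⟩ := Nat.exists_eq_add_of_le hk
  simp only [Nat.add_sub_cancel_left]
  set t : ℕ → ℕ := fun j => k ^ j * m ^ (k + m - j) * (k + m).choose j with ht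
  change t j ≤ k ^ k * m ^ m * (k + m).choose k
  have htk : k ^ k * m ^ m * (k + m).choose k = t k := by simp [ht]
  rw [htk]
  have hstep : ∀ i, i < k + m → t (i + 1) * ((i + 1) * m) = t i * (k * (k + m - i)) := by
    intro i hi
    have h1 := Nat.choose_succ_right_eq (k + m) i
    have h2 : k + m - i = (k + m - (i + 1)) + 1 := by omega
    simp only [ht]
    rw [show m ^ (k + m - i) = m ^ (k + m - (i + 1)) * m by rw [h2, pow_succ], pow_succ]
    linear_combination (k ^ i * k * m ^ (k + m - (i + 1)) * m) * h1
  rcases Nat.eq_zero_or_pos m with rfl | hm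
  · rcases hj.lt_or_eq with h | h
    · simp [ht, zero_pow (show k - j ≠ 0 by omega)]
    · simp at h; rw [h]
  rcases le_total j k with h | h
  · refine Nat.decreasingInduction' (P := fun i => t i ≤ t k) ?_ h le_rfl
    intro i hik _ ih
    refine le_trans ?_ ih
    have hs := hstep i (by omega)
    have hpos : 0 < (i + 1) * m := by positivity
    refine Nat.le_of_mul_le_mul_right (c := (i + 1) * m) ?_ hpos
    rw [hs]
    refine Nat.mul_le_mul_left _ ?_
    obtain ⟨d, rfl⟩ := Nat.exists_eq_add_of_lt hik
    rw [show i + d + 1 + m - i = d + 1 + m by omega]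
    nlinarith
  · induction j, h using Nat.le_induction with
    | base => exact le_rfl
    | succ i hi ih =>
      refine le_trans ?_ (ih (by omega))
      have hs := hstep i (by omega)
      have hpos : 0 < (i + 1) * m := by positivity
      refine Nat.le_of_mul_le_mul_right (c := (i + 1) * m) ?_ hpos
      rw [hs]
      refine Nat.mul_le_mul_left _ ?_
      obtain ⟨d, rfl⟩ := Nat.exists_eq_add_of_le hi
      obtain ⟨e, rfl⟩ : ∃ e, m = d + e := ⟨m - d, by omega⟩
      rw [show k + (d + e) - (k + d) = e by omega]
      nlinarith [Nat.zero_le (d * d), Nat.zero_le (d * e), Nat.zero_le (k * d)]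

lemma pow_le_choose_mul_pow (n k : ℕ) (hk : k ≤ n) :
    n ^ n ≤ (n + 1) * (n.choose k * (k ^ k * (n - k) ^ (n - k))) := by
  have h := add_pow k (n - k) n
  rw [Nat.add_sub_cancel' hk] at h
  rw [h]
  refine (Finset.sum_le_card_nsmul _ _ _ fun j hj =>
    binomial_term_le_mode n k hk j (by simpa [Nat.lt_succ_iff] using hj)).trans (le_of_eq ?_)
  simp only [Finset.card_range, smul_eq_mul]
  ring

lemma mul_binEntropy_div (n k : ℕ) (hn : 0 < n) (hk : k ≤ n) :
    n * Real.binEntropy (k / n) =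
      n * Real.log n - (k * Real.log k + (n - k : ℕ) * Real.log (n - k : ℕ)) := by
  have hn' : (n : ℝ) ≠ 0 := by positivity
  obtain ⟨m, rfl⟩ := Nat.exists_eq_add_of_le hk
  simp only [Nat.add_sub_cancel_left]
  have hone : 1 - (k : ℝ) / ((k + m : ℕ) : ℝ) = m / ((k + m : ℕ) : ℝ) := by
    field_simp; push_cast; ring
  have key : ∀ a : ℕ, ((k + m : ℕ) : ℝ) * ((a / ((k + m : ℕ) : ℝ)) *
      Real.log (a / ((k + m : ℕ) : ℝ))⁻¹) = a * Real.log ((k + m : ℕ) : ℝ) - a * Real.log a := by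
    intro a
    rcases Nat.eq_zero_or_pos a with rfl | ha
    · simp
    · rw [Real.log_inv, Real.log_div (by positivity) hn']
      field_simp
      ring
  rw [Real.binEntropy, hone, mul_add, key, key]
  push_cast
  ring

lemma cast_pow_self_pos (a : ℕ) : 0 < (a : ℝ) ^ a := by
  rcases Nat.eq_zero_or_pos a with rfl | ha
  · simp
  · positivity

lemma log_pow_self_mul_pow_self (k m : ℕ) :
    Real.log ((k : ℝ) ^ k * (m : ℝ) ^ m) = k * Real.log k + m * Real.log m := by
  rw [Real.log_mul (cast_pow_self_pos k).ne' (cast_pow_self_pos m).ne', Real.log_pow, Real.log_pow]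

/-- Expected number of equilibria in which exactly `k` of the `n` players have payoff `1`. -/
def expectedCount (n k : ℕ) : ℝ := n.choose k * 2 ^ k / 2 ^ n

lemma expectedCount_nonneg (n k : ℕ) : 0 ≤ expectedCount n k := by
  unfold expectedCount; positivity

lemma log_expectedCount (n k : ℕ) (hn : 0 < n) (hk : k ≤ n) :
    Real.log (expectedCount n k) = n * growthRate (k / n) +
      (Real.log (n.choose k * ((k : ℝ) ^ k * ((n - k : ℕ) : ℝ) ^ (n - k))) -
        n * Real.log n) := by
  have hc : (n.choose k : ℝ) ≠ 0 := by exact_mod_cast (Nat.choose_pos hk).ne'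
  have hpp : ((k : ℝ) ^ k * ((n - k : ℕ) : ℝ) ^ (n - k)) ≠ 0 :=
    (mul_pos (cast_pow_self_pos _) (cast_pow_self_pos _)).ne'
  have hn' : (n : ℝ) ≠ 0 := by positivity
  have e : (n : ℝ) * ((1 - k / n) * Real.log 2) = (n - k) * Real.log 2 := by
    field_simp
  rw [expectedCount, Real.log_div (by positivity) (by positivity),
    Real.log_mul hc (by positivity), Real.log_mul hc hpp, log_pow_self_mul_pow_self,
    Real.log_pow, Real.log_pow, growthRate, mul_sub, mul_binEntropy_div n k hn hk, e]
  ring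

lemma choose_mul_pow_pos (n k : ℕ) (hk : k ≤ n) :
    0 < (n.choose k : ℝ) * ((k : ℝ) ^ k * ((n - k : ℕ) : ℝ) ^ (n - k)) :=
  mul_pos (by exact_mod_cast Nat.choose_pos hk)
    (mul_pos (cast_pow_self_pos _) (cast_pow_self_pos _))

lemma expectedCount_pos (n k : ℕ) (hk : k ≤ n) : 0 < expectedCount n k := by
  have hc : 0 < (n.choose k : ℝ) := by exact_mod_cast Nat.choose_pos hk
  unfold expectedCount; positivity

lemma expectedCount_le (n k : ℕ) (hn : 0 < n) (hk : k ≤ n) :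
    expectedCount n k ≤ Real.exp (n * growthRate (k / n)) := by
  rw [← Real.log_le_iff_le_exp (expectedCount_pos n k hk), log_expectedCount n k hn hk]
  have h : (n.choose k : ℝ) * ((k : ℝ) ^ k * ((n - k : ℕ) : ℝ) ^ (n - k)) ≤ (n : ℝ) ^ n := by
    exact_mod_cast choose_mul_pow_le n k hk
  have := Real.log_le_log (choose_mul_pow_pos n k hk) h
  rw [Real.log_pow] at this
  linarith

lemma le_expectedCount (n k : ℕ) (hn : 0 < n) (hk : k ≤ n) :
    Real.exp (n * growthRate (k / n)) / (n + 1) ≤ expectedCount n k := by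
  have hpos : (0 : ℝ) < n + 1 := by positivity
  rw [← Real.exp_log (expectedCount_pos n k hk), ← Real.exp_log hpos, ← Real.exp_sub,
    Real.exp_le_exp, log_expectedCount n k hn hk]
  have h : (n : ℝ) ^ n ≤
      (n + 1) * ((n.choose k : ℝ) * ((k : ℝ) ^ k * ((n - k : ℕ) : ℝ) ^ (n - k))) := by
    exact_mod_cast pow_le_choose_mul_pow n k hk
  have := Real.log_le_log (by positivity) h
  rw [Real.log_pow, Real.log_mul hpos.ne' (choose_mul_pow_pos n k hk).ne'] at this
  linarith

lemma tendsto_exp_mul_div_succ {c : ℝ} (hc : 0 < c) :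
    Tendsto (fun n : ℕ => Real.exp (n * c) / (n + 1)) atTop atTop := by
  have h1 : Tendsto (fun x : ℝ => Real.exp (c * x) / x ^ 1) atTop atTop :=
    tendsto_exp_mul_div_rpow_atTop 1 c hc |>.congr fun x => by simp
  have h2 := (h1.comp (tendsto_natCast_atTop_atTop (R := ℝ))).comp (tendsto_add_atTop_nat 1)
  have h3 := h2.const_mul_atTop (Real.exp_pos (-c))
  refine h3.congr fun n => ?_
  simp only [Function.comp, pow_one]
  rw [← mul_div_assoc, ← Real.exp_add]
  push_cast
  congr 2
  ring

lemma tendsto_succ_mul_exp_neg {c : ℝ} (hc : 0 < c) :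
    Tendsto (fun n : ℕ => ((n : ℝ) + 1) * Real.exp (-(n * c))) atTop (𝓝 0) := by
  refine (tendsto_exp_mul_div_succ hc).inv_tendsto_atTop.congr fun n => ?_
  simp only [Pi.inv_apply]
  rw [inv_div, Real.exp_neg, div_eq_mul_inv]

lemma tendsto_expectedCount_floor {x : ℝ} (hx0 : 0 ≤ x) (hx1 : x ≤ 1) (hx : 0 < growthRate x) :
    Tendsto (fun n : ℕ => expectedCount n ⌊x * n⌋₊) atTop atTop := by
  have hlim : Tendsto (fun n : ℕ => growthRate ((⌊x * n⌋₊ : ℝ) / n)) atTop (𝓝 (growthRate x)) :=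
    (continuous_growthRate.tendsto x).comp
      ((tendsto_nat_floor_mul_div_atTop hx0).comp tendsto_natCast_atTop_atTop)
  refine tendsto_atTop_mono' _ ?_ (tendsto_exp_mul_div_succ (half_pos hx))
  filter_upwards [hlim.eventually (lt_mem_nhds (half_lt_self hx)), eventually_gt_atTop 0]
    with n hn hn0
  have hk : ⌊x * n⌋₊ ≤ n := Nat.floor_le_of_le (by nlinarith [(n.cast_nonneg : (0:ℝ) ≤ n)])
  refine le_trans ?_ (le_expectedCount n _ hn0 hk)
  gcongr

lemma tendsto_sum_expectedCount {y : ℝ} (hy : y < xweqHalf) :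
    Tendsto (fun n : ℕ => ∑ k ∈ (Finset.range (n + 1)).filter (fun k : ℕ => (k : ℝ) / n < y),
      expectedCount n k) atTop (𝓝 0) := by
  rcases lt_or_ge y 0 with hy0 | hy0
  · refine tendsto_const_nhds.congr fun n => ?_
    rw [Finset.filter_false_of_mem, Finset.sum_empty]
    intro k _
    have : (0 : ℝ) ≤ k / n := by positivity
    linarith
  obtain ⟨z, hz, hmax⟩ := isCompact_Icc.exists_isMaxOn (nonempty_Icc.2 hy0)
    continuous_growthRate.continuousOn
  have hzneg := growthRate_neg_of_lt_xweqHalf hz.1 (hz.2.trans_lt hy)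
  refine squeeze_zero' (Eventually.of_forall fun n =>
    Finset.sum_nonneg fun k _ => expectedCount_nonneg n k) ?_
    (tendsto_succ_mul_exp_neg (neg_pos.2 hzneg))
  filter_upwards [eventually_gt_atTop 0] with n hn
  have hterm : ∀ k ∈ (Finset.range (n + 1)).filter (fun k : ℕ => (k : ℝ) / n < y),
      expectedCount n k ≤ Real.exp (-(n * -growthRate z)) := by
    intro k hk
    rw [Finset.mem_filter, Finset.mem_range] at hk
    refine (expectedCount_le n k hn (by omega)).trans (Real.exp_le_exp.2 ?_)
    have : growthRate (k / n) ≤ growthRate z := hmax ⟨by positivity, hk.2.le⟩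
    rw [mul_neg, neg_neg]
    gcongr
  refine (Finset.sum_le_card_nsmul _ _ _ hterm).trans ?_
  rw [nsmul_eq_mul]
  gcongr
  have := Finset.card_filter_le (Finset.range (n + 1)) (fun k : ℕ => (k : ℝ) / n < y)
  rw [Finset.card_range] at this
  exact_mod_cast this

/-! ### Local views of a game -/

/-- The payoffs that decide whether `σ` is an equilibrium of `Γ`: for each player, the payoff at
`σ` and the payoff after deviating. -/
def localView {n : ℕ} (Γ : Fin n → (Fin n → Bool) → Bool) (σ : Fin n → Bool) :
    Fin n → Bool × Bool :=
  fun i => (Γ i σ, Γ i (flipStrat σ i))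

lemma flipStrat_flipStrat {n : ℕ} (σ : Fin n → Bool) (i : Fin n) :
    flipStrat (flipStrat σ i) i = σ := by
  simp [flipStrat]

/-- A set of profiles containing exactly one endpoint of each unilateral deviation. -/
def IsParityClass {n : ℕ} (C : Set (Fin n → Bool)) : Prop :=
  ∀ σ i, flipStrat σ i ∈ C ↔ σ ∉ C

lemma IsParityClass.compl {n : ℕ} {C : Set (Fin n → Bool)} (hC : IsParityClass C) :
    IsParityClass Cᶜ := fun σ i => by
  simp only [mem_compl_iff, hC σ i]

/-- The profiles in which an even number of players use strategy `1`. -/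
def evenProfiles (n : ℕ) : Set (Fin n → Bool) :=
  {σ | ∑ i, (if σ i then 1 else 0 : ZMod 2) = 0}

lemma isParityClass_evenProfiles (n : ℕ) : IsParityClass (evenProfiles n) := by
  intro σ i
  have h : ∑ j, (if flipStrat σ i j then 1 else 0 : ZMod 2) =
      (∑ j, (if σ j then 1 else 0 : ZMod 2)) + 1 := by
    rw [← Finset.add_sum_erase _ _ (Finset.mem_univ i),
      ← Finset.add_sum_erase (a := i) _ (fun j => (if σ j then 1 else 0 : ZMod 2))
        (Finset.mem_univ i),
      Finset.sum_congr rfl (g := fun j => (if σ j then 1 else 0 : ZMod 2))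
        fun j hj => by simp [flipStrat, Function.update_of_ne (Finset.ne_of_mem_erase hj)]]
    cases hσ : σ i
    · simp [flipStrat, hσ, add_comm]
    · have : (1 + 1 : ZMod 2) = 0 := by decide
      simp [flipStrat, hσ]
      rw [add_right_comm, this, zero_add]
  have hz : ∀ z : ZMod 2, z + 1 = 0 ↔ ¬ z = 0 := by decide
  simp only [evenProfiles, mem_ofPred_eq, h, hz]

open Classical in
/-- A game is determined by its local views at a parity class, and these are arbitrary. -/
def localViewEquiv {n : ℕ} {C : Set (Fin n → Bool)} (hC : IsParityClass C) :
    (Fin n → (Fin n → Bool) → Bool) ≃ (C → Fin n → Bool × Bool) where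
  toFun Γ σ := localView Γ σ
  invFun v i τ :=
    if h : τ ∈ C then (v ⟨τ, h⟩ i).1 else (v ⟨flipStrat τ i, (hC τ i).2 h⟩ i).2
  left_inv Γ := by
    funext i τ
    by_cases h : τ ∈ C <;> simp [h, localView, flipStrat_flipStrat]
  right_inv v := by
    funext σ i
    have hσ : flipStrat σ.1 i ∉ C := fun h => (hC σ.1 i).1 h σ.2
    simp [localView, hσ, flipStrat_flipStrat]

lemma IsParityClass.card {n : ℕ} (hn : 0 < n) {C : Set (Fin n → Bool)} (hC : IsParityClass C) :
    Nat.card C = 2 ^ (n - 1) := by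
  have h := Nat.card_congr (localViewEquiv hC)
  have hbool : Nat.card Bool = 2 := by simp
  simp only [Nat.card_fun, Nat.card_prod, Nat.card_fin, hbool] at h
  rw [show (2 * 2 : ℕ) = 2 ^ 2 by norm_num, ← pow_mul, ← pow_mul, ← pow_mul] at h
  have h2 := Nat.pow_right_injective le_rfl h
  have h3 : 2 ^ n = 2 * 2 ^ (n - 1) := by rw [← pow_succ']; congr 1; omega
  rw [h3] at h2
  have : n * (2 * 2 ^ (n - 1)) = n * (2 * Nat.card C) := by rw [mul_comm, h2]; ring
  have := Nat.eq_of_mul_eq_mul_left hn this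
  omega

/-- The proportion of games lying in `A`. -/
def gameDensity {n : ℕ} (A : Set (Fin n → (Fin n → Bool) → Bool)) : ℝ :=
  (A.ncard : ℝ) / Nat.card (Fin n → (Fin n → Bool) → Bool)

lemma gameDensity_mono {n : ℕ} {A B : Set (Fin n → (Fin n → Bool) → Bool)} (h : A ⊆ B) :
    gameDensity A ≤ gameDensity B := by
  unfold gameDensity
  gcongr
  exact B.toFinite

lemma gameDensity_nonneg {n : ℕ} (A : Set (Fin n → (Fin n → Bool) → Bool)) :
    0 ≤ gameDensity A := by
  unfold gameDensity; positivity

lemma gameDensity_union_le {n : ℕ} (A B : Set (Fin n → (Fin n → Bool) → Bool)) :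
    gameDensity (A ∪ B) ≤ gameDensity A + gameDensity B := by
  unfold gameDensity
  rw [← add_div]
  gcongr
  exact_mod_cast Set.ncard_union_le A B

lemma gameDensity_compl {n : ℕ} (A : Set (Fin n → (Fin n → Bool) → Bool)) :
    gameDensity Aᶜ = 1 - gameDensity A := by
  unfold gameDensity
  have h : (A.ncard : ℝ) + (Aᶜ.ncard : ℝ) = Nat.card (Fin n → (Fin n → Bool) → Bool) := by
    exact_mod_cast Set.ncard_add_ncard_compl A
  have hpos : (0 : ℝ) < Nat.card (Fin n → (Fin n → Bool) → Bool) := by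
    exact_mod_cast Nat.card_pos
  field_simp
  linarith

lemma gameDensity_avoid {n : ℕ} (hn : 0 < n) {C : Set (Fin n → Bool)} (hC : IsParityClass C)
    (S : Finset (Fin n → Bool × Bool)) :
    gameDensity {Γ | ∀ σ ∈ C, localView Γ σ ∉ S} =
      (1 - (S.card : ℝ) / 4 ^ n) ^ (2 ^ (n - 1)) := by
  classical
  have hcard : ({Γ : Fin n → (Fin n → Bool) → Bool | ∀ σ ∈ C, localView Γ σ ∉ S}).ncard =
      (Sᶜ.card) ^ (2 ^ (n - 1)) := by
    have himg : {Γ : Fin n → (Fin n → Bool) → Bool | ∀ σ ∈ C, localView Γ σ ∉ S} =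
        (localViewEquiv hC) ⁻¹' (Fintype.piFinset fun _ : C => Sᶜ : Finset _) := by
      ext Γ
      simp [localViewEquiv]
    rw [himg, Set.ncard_preimage_of_injective_subset_range (localViewEquiv hC).injective
      (by simp), Set.ncard_coe_finset, Fintype.card_piFinset]
    simp only [Finset.prod_const, Finset.card_univ]
    rw [← Nat.card_eq_fintype_card, hC.card hn]
  have htot : Nat.card (Fin n → (Fin n → Bool) → Bool) = (4 ^ n) ^ (2 ^ (n - 1)) := by
    rw [Nat.card_congr (localViewEquiv hC), Nat.card_fun, hC.card hn]
    simp
  have hS : (Sᶜ.card : ℝ) = 4 ^ n - S.card := by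
    rw [Finset.card_compl, Nat.cast_sub (Finset.card_le_univ S)]
    simp
  rw [gameDensity, hcard, htot]
  push_cast
  rw [← div_pow, hS, sub_div, div_self (by positivity)]

lemma gameDensity_avoid_le {n : ℕ} (hn : 0 < n) {C : Set (Fin n → Bool)} (hC : IsParityClass C)
    (S : Finset (Fin n → Bool × Bool)) :
    gameDensity {Γ | ∀ σ ∈ C, localView Γ σ ∉ S} ≤ Real.exp (-((S.card : ℝ) / 2 ^ n / 2)) := by
  rw [gameDensity_avoid hn hC]
  have hle : (S.card : ℝ) / 4 ^ n ≤ 1 := by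
    rw [div_le_one (by positivity)]
    have := Finset.card_le_univ S
    simp at this
    exact_mod_cast this
  have h := Real.add_one_le_exp (-((S.card : ℝ) / 4 ^ n))
  calc _ ≤ (Real.exp (-((S.card : ℝ) / 4 ^ n))) ^ (2 ^ (n - 1)) :=
        pow_le_pow_left₀ (by linarith) (by linarith) _
    _ = _ := by
      rw [← Real.exp_nat_mul]
      congr 1
      obtain ⟨m, rfl⟩ := Nat.exists_eq_succ_of_ne_zero hn.ne'
      rw [show (4 : ℝ) = 2 * 2 by norm_num, mul_pow]
      simp [pow_succ]
      field_simp

lemma gameDensity_hit_le {n : ℕ} (hn : 0 < n) {C : Set (Fin n → Bool)} (hC : IsParityClass C)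
    (S : Finset (Fin n → Bool × Bool)) :
    gameDensity {Γ | ∃ σ ∈ C, localView Γ σ ∈ S} ≤ (S.card : ℝ) / 2 ^ n / 2 := by
  have hcompl : {Γ : Fin n → (Fin n → Bool) → Bool | ∃ σ ∈ C, localView Γ σ ∈ S} =
      {Γ | ∀ σ ∈ C, localView Γ σ ∉ S}ᶜ := by
    ext Γ; simp
  rw [hcompl, gameDensity_compl, gameDensity_avoid hn hC]
  have hle : (S.card : ℝ) / 4 ^ n ≤ 1 := by
    rw [div_le_one (by positivity)]
    have := Finset.card_le_univ S
    simp at this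
    exact_mod_cast this
  have h := one_add_mul_le_pow (a := -((S.card : ℝ) / 4 ^ n)) (by linarith) (2 ^ (n - 1))
  have e : ((2 ^ (n - 1) : ℕ) : ℝ) * -((S.card : ℝ) / 4 ^ n) = -((S.card : ℝ) / 2 ^ n / 2) := by
    obtain ⟨m, rfl⟩ := Nat.exists_eq_succ_of_ne_zero hn.ne'
    rw [show (4 : ℝ) = 2 * 2 by norm_num, mul_pow]
    simp [pow_succ]
    field_simp
  rw [e] at h
  rw [sub_eq_add_neg 1 ((S.card : ℝ) / 4 ^ n)]
  linarith

/-- Number of players with payoff `1` in a local view. -/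
def utilityCount {n : ℕ} (v : Fin n → Bool × Bool) : ℕ :=
  (Finset.univ.filter fun i => (v i).1 = true).card

/-- The local views of equilibria whose utility count lies in `K`. -/
def equilibriumViews (n : ℕ) (K : Finset ℕ) : Finset (Fin n → Bool × Bool) :=
  Finset.univ.filter fun v => (∀ i, v i ≠ (false, true)) ∧ utilityCount v ∈ K

lemma card_equilibriumViews (n : ℕ) (K : Finset ℕ) :
    (equilibriumViews n K).card = ∑ k ∈ K, n.choose k * 2 ^ k := by
  classical
  rw [Finset.card_eq_sum_card_fiberwise (f := utilityCount) (t := K)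
    fun v hv => (Finset.mem_filter.1 hv).2.2]
  refine Finset.sum_congr rfl fun k hk => ?_
  rw [Finset.card_eq_sum_card_fiberwise
    (f := fun v : Fin n → Bool × Bool => Finset.univ.filter fun i => (v i).1 = true)
    (t := Finset.powersetCard k Finset.univ)]
  · rw [Finset.sum_congr rfl (g := fun _ => 2 ^ k)]
    · simp
    intro T hT
    have hT' := (Finset.mem_powersetCard.1 hT).2
    have : (Finset.filter (fun v : Fin n → Bool × Bool =>
        (Finset.univ.filter fun i => (v i).1 = true) = T)
        ((equilibriumViews n K).filter fun v => utilityCount v = k)) =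
        Fintype.piFinset fun i => if i ∈ T then {(true, true), (true, false)}
          else {(false, false)} := by
      ext v
      simp only [Finset.mem_filter, equilibriumViews, Finset.mem_univ, true_and,
        Fintype.mem_piFinset]
      constructor
      · rintro ⟨⟨⟨hok, -⟩, -⟩, rfl⟩ i
        have := hok i
        rcases hv : v i with ⟨_ | _, _ | _⟩ <;> simp_all
      · intro h
        have hset : (Finset.univ.filter fun i => (v i).1 = true) = T := by
          ext i
          have := h i
          by_cases hi : i ∈ T
          · simp only [hi, if_true, Finset.mem_insert, Finset.mem_singleton] at this
            rcases this with h | h <;> simp [h, hi]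
          · simp only [hi, if_false, Finset.mem_singleton] at this
            simp [this, hi]
        have hu : utilityCount v = k := by rw [utilityCount, hset, hT']
        refine ⟨⟨⟨fun i hi => ?_, hu ▸ hk⟩, hu⟩, hset⟩
        have := h i
        rw [hi] at this
        split_ifs at this <;> simp at this
    rw [this, Fintype.card_piFinset, ← hT']
    have hc : ∀ i, (if i ∈ T then ({(true, true), (true, false)} : Finset (Bool × Bool))
        else {(false, false)}).card = if i ∈ T then 2 else 1 := by
      intro i; split_ifs <;> rfl
    simp [hc]
  · intro v hv
    have := (Finset.mem_filter.1 hv).2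
    simpa [Finset.mem_powersetCard, utilityCount] using this

lemma card_equilibriumViews_div (n : ℕ) (K : Finset ℕ) :
    ((equilibriumViews n K).card : ℝ) / 2 ^ n = ∑ k ∈ K, expectedCount n k := by
  rw [card_equilibriumViews]
  push_cast
  rw [Finset.sum_div]
  rfl

lemma ASUb_eq {n : ℕ} (Γ : Fin n → (Fin n → Bool) → Bool) (σ : Fin n → Bool) :
    ASUb Γ σ = (utilityCount (localView Γ σ) : ℝ) / n := by
  unfold ASUb pay utilityCount localView
  rw [Finset.sum_boole]
  ring

lemma isPNEb_iff {n : ℕ} (Γ : Fin n → (Fin n → Bool) → Bool) (σ : Fin n → Bool) :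
    isPNEb Γ σ ↔ ∀ i, localView Γ σ i ≠ (false, true) := by
  unfold isPNEb pay localView
  refine forall_congr' fun i => ?_
  cases Γ i σ <;> cases Γ i (flipStrat σ i) <;> norm_num

lemma localView_mem_equilibriumViews {n : ℕ} {Γ : Fin n → (Fin n → Bool) → Bool}
    {σ : Fin n → Bool} {K : Finset ℕ} :
    localView Γ σ ∈ equilibriumViews n K ↔ isPNEb Γ σ ∧ utilityCount (localView Γ σ) ∈ K := by
  simp [equilibriumViews, isPNEb_iff]

lemma utilityCount_le {n : ℕ} (v : Fin n → Bool × Bool) : utilityCount v ≤ n :=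
  (Finset.card_le_univ _).trans (by simp)

lemma ASUb_mem_Icc {n : ℕ} (Γ : Fin n → (Fin n → Bool) → Bool) (σ : Fin n → Bool) :
    ASUb Γ σ ∈ Icc (0 : ℝ) 1 := by
  rw [ASUb_eq]
  refine ⟨by positivity, div_le_one_of_le₀ ?_ (by positivity)⟩
  exact_mod_cast utilityCount_le _

lemma SOb_le_one {n : ℕ} (Γ : Fin n → (Fin n → Bool) → Bool) : SOb Γ ≤ 1 :=
  ciSup_le fun σ => (ASUb_mem_Icc Γ σ).2

lemma BEqb_le_one {n : ℕ} (Γ : Fin n → (Fin n → Bool) → Bool) : BEqb Γ ≤ 1 :=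
  Real.sSup_le (by rintro _ ⟨σ, -, rfl⟩; exact (ASUb_mem_Icc Γ σ).2) zero_le_one

lemma le_SOb {n : ℕ} (Γ : Fin n → (Fin n → Bool) → Bool) (σ : Fin n → Bool) :
    ASUb Γ σ ≤ SOb Γ :=
  le_ciSup (f := fun σ => ASUb Γ σ) (Set.finite_range _).bddAbove σ

lemma le_BEqb {n : ℕ} {Γ : Fin n → (Fin n → Bool) → Bool} {σ : Fin n → Bool}
    (hσ : isPNEb Γ σ) : ASUb Γ σ ≤ BEqb Γ :=
  le_csSup (Set.toFinite _).bddAbove ⟨σ, hσ, rfl⟩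

lemma WEqb_le {n : ℕ} {Γ : Fin n → (Fin n → Bool) → Bool} {σ : Fin n → Bool}
    (hσ : isPNEb Γ σ) : WEqb Γ ≤ ASUb Γ σ :=
  csInf_le (Set.toFinite _).bddBelow ⟨σ, hσ, rfl⟩

/-- Almost every game has an equilibrium of average utility close to any level of positive
growth rate. -/
lemma tendsto_gameDensity_avoid {x : ℝ} (hx0 : 0 ≤ x) (hx1 : x ≤ 1) (hx : 0 < growthRate x) :
    Tendsto (fun n : ℕ => gameDensity {Γ : Fin n → (Fin n → Bool) → Bool |
      ∀ σ ∈ evenProfiles n, localView Γ σ ∉ equilibriumViews n {⌊x * n⌋₊}}) atTop (𝓝 0) := by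
  have h := Real.tendsto_exp_neg_atTop_nhds_zero.comp
    ((tendsto_expectedCount_floor hx0 hx1 hx).atTop_div_const two_pos)
  refine squeeze_zero' (Eventually.of_forall fun n => gameDensity_nonneg _) ?_ h
  filter_upwards [eventually_gt_atTop 0] with n hn
  have := gameDensity_avoid_le hn (isParityClass_evenProfiles n)
    (equilibriumViews n {⌊x * n⌋₊})
  rwa [card_equilibriumViews_div, Finset.sum_singleton] at this

/-- Almost no game has an equilibrium of average utility below a level less than `xweqHalf`. -/
lemma tendsto_gameDensity_hit {y : ℝ} (hy : y < xweqHalf) (C : ∀ n : ℕ, Set (Fin n → Bool))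
    (hC : ∀ n, IsParityClass (C n)) :
    Tendsto (fun n : ℕ => gameDensity {Γ : Fin n → (Fin n → Bool) → Bool |
      ∃ σ ∈ C n, localView Γ σ ∈ equilibriumViews n
        ((Finset.range (n + 1)).filter fun k : ℕ => (k : ℝ) / n < y)}) atTop (𝓝 0) := by
  have h := (tendsto_sum_expectedCount hy).div_const 2
  rw [zero_div] at h
  refine squeeze_zero' (Eventually.of_forall fun n => gameDensity_nonneg _) ?_ h
  filter_upwards [eventually_gt_atTop 0] with n hn
  have := gameDensity_hit_le hn (hC n) (equilibriumViews n
        ((Finset.range (n + 1)).filter fun k : ℕ => (k : ℝ) / n < y))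
  rwa [card_equilibriumViews_div] at this

/-- Asymptotically almost every `n`-player game with binary payoffs has social optimum and
best-equilibrium ASU within `ε` of `1` and worst-equilibrium ASU within `ε` of
`x_weq(1/2)`: the fraction of such games among all `2^{n·2^n}` games tends to `1`. -/
theorem fraction_good_binary_games_tendsto_one :
    ∀ ε : ℝ, 0 < ε →
      Tendsto
        (fun n : ℕ =>
          (Set.ncard {Γ : Fin n → (Fin n → Bool) → Bool |
              WEqb Γ ∈ Icc (xweqHalf - ε) (xweqHalf + ε) ∧
              SOb Γ ∈ Icc (1 - ε) 1 ∧ BEqb Γ ∈ Icc (1 - ε) 1} : ℝ) /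
            (Nat.card (Fin n → (Fin n → Bool) → Bool) : ℝ))
        atTop (𝓝 1) := by
  intro ε hε
  obtain ⟨x, hx, hx'⟩ := exists_between (lt_min xweqHalf_lt_one (lt_add_of_pos_right xweqHalf hε))
  obtain ⟨z, hz, hz1⟩ := exists_between (max_lt xweqHalf_lt_one (sub_lt_self (1 : ℝ) hε))
  rw [lt_min_iff] at hx'
  rw [max_lt_iff] at hz
  have h0 := xweqHalf_mem.1.1
  have hxlow := tendsto_gameDensity_avoid (by linarith) hx'.1.le (growthRate_pos hx hx'.1)
  have hzhigh := tendsto_gameDensity_avoid (by linarith) hz1.le (growthRate_pos hz.1 hz1)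
  have heven := tendsto_gameDensity_hit (sub_lt_self xweqHalf hε) evenProfiles
    isParityClass_evenProfiles
  have hodd := tendsto_gameDensity_hit (sub_lt_self xweqHalf hε) (fun n => (evenProfiles n)ᶜ)
    fun n => (isParityClass_evenProfiles n).compl
  have hlim := (tendsto_const_nhds (x := (1 : ℝ))).sub ((hxlow.add hzhigh).add (heven.add hodd))
  simp only [add_zero, sub_zero] at hlim
  have hfloor : ∀ᶠ n : ℕ in atTop, 1 - ε < (⌊z * n⌋₊ : ℝ) / n :=
    ((tendsto_nat_floor_mul_div_atTop (by linarith : 0 ≤ z)).comp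
      tendsto_natCast_atTop_atTop).eventually (lt_mem_nhds hz.2)
  change Tendsto (fun n : ℕ => gameDensity {Γ : Fin n → (Fin n → Bool) → Bool |
    WEqb Γ ∈ Icc (xweqHalf - ε) (xweqHalf + ε) ∧
      SOb Γ ∈ Icc (1 - ε) 1 ∧ BEqb Γ ∈ Icc (1 - ε) 1}) atTop (𝓝 1)
  refine tendsto_of_tendsto_of_tendsto_of_le_of_le' hlim tendsto_const_nhds ?_
    (Eventually.of_forall fun n => ?_)
  · filter_upwards [hfloor, eventually_gt_atTop 0] with n hn hn0
    have hn' : (0 : ℝ) < n := by exact_mod_cast hn0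
    refine le_trans (sub_le_sub_left ((gameDensity_union_le _ _).trans
      (add_le_add (gameDensity_union_le _ _) (gameDensity_union_le _ _))) 1) ?_
    rw [← gameDensity_compl]
    refine gameDensity_mono fun Γ hΓ => ?_
    simp only [mem_compl_iff, mem_union, mem_ofPred_eq, not_or, not_forall, not_exists, not_and,
      not_not, exists_prop, localView_mem_equilibriumViews, Finset.mem_singleton] at hΓ
    obtain ⟨⟨⟨σ, -, hσ, hσx⟩, ⟨τ, -, hτ, hτz⟩⟩, hev, hod⟩ := hΓ
    have hτge : 1 - ε ≤ ASUb Γ τ := by rw [ASUb_eq, hτz]; exact hn.le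
    have hσle : ASUb Γ σ ≤ xweqHalf + ε := by
      rw [ASUb_eq, hσx]
      refine le_trans ?_ hx'.2.le
      rw [div_le_iff₀ hn']
      exact Nat.floor_le (mul_nonneg (by linarith) hn'.le)
    refine ⟨⟨?_, (WEqb_le hσ).trans hσle⟩, ⟨hτge.trans (le_SOb Γ τ), SOb_le_one Γ⟩,
      hτge.trans (le_BEqb hτ), BEqb_le_one Γ⟩
    refine le_csInf ⟨_, σ, hσ, rfl⟩ ?_
    rintro _ ⟨ρ, hρ, rfl⟩
    by_contra! hlt
    have hmem : utilityCount (localView Γ ρ) ∈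
        (Finset.range (n + 1)).filter fun k : ℕ => (k : ℝ) / n < xweqHalf - ε := by
      rw [Finset.mem_filter, Finset.mem_range, ← ASUb_eq]
      exact ⟨Nat.lt_succ_of_le (utilityCount_le _), hlt⟩
    by_cases hpar : ρ ∈ evenProfiles n
    · exact hev ρ hpar hρ hmem
    · exact hod ρ hpar hρ hmem
  · have h1 := gameDensity_compl {Γ : Fin n → (Fin n → Bool) → Bool |
      WEqb Γ ∈ Icc (xweqHalf - ε) (xweqHalf + ε) ∧
        SOb Γ ∈ Icc (1 - ε) 1 ∧ BEqb Γ ∈ Icc (1 - ε) 1}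
    have h2 := gameDensity_nonneg {Γ : Fin n → (Fin n → Bool) → Bool |
      WEqb Γ ∈ Icc (xweqHalf - ε) (xweqHalf + ε) ∧
        SOb Γ ∈ Icc (1 - ε) 1 ∧ BEqb Γ ∈ Icc (1 - ε) 1}ᶜ
    linarith
end
end

section
/- Let X, X' be independent random variables with common distribution function F and let α = P(X = X'). Then for every y ∈ ℝ, the conditional distribution function satisfies P(X ≤ y | X ≥ X') = (2/(1+α)) · [F(y)² − ∫_{(−∞,y]} F(x⁻) dF(x)], where F(x⁻) denotes the left limit of F at x and the integral is the Lebesgue–Stieltjes integral with respect to F. -/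
open MeasureTheory ProbabilityTheory Filter Set Topology
open scoped ENNReal

noncomputable section

/-- `σ` is a pure Nash equilibrium of the game with payoffs `u` in state `ω`. -/
def isPNE {Ω : Type*} {n : ℕ} (u : Fin n → (Fin n → Bool) → Ω → ℝ)
    (σ : Fin n → Bool) (ω : Ω) : Prop :=
  ∀ i : Fin n, u i (flipStrat σ i) ω ≤ u i σ ω

/-- Average social utility of profile `σ`. -/
def ASU {Ω : Type*} {n : ℕ} (u : Fin n → (Fin n → Bool) → Ω → ℝ)
    (σ : Fin n → Bool) (ω : Ω) : ℝ :=
  (1 / (n : ℝ)) * ∑ i : Fin n, u i σ ω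

/-- Convergence in probability of a sequence of real random variables to a constant. -/
def ConvInProb {Ω : Type*} [MeasurableSpace Ω] (P : Measure Ω)
    (U : ℕ → Ω → ℝ) (c : ℝ) : Prop :=
  ∀ ε : ℝ, 0 < ε → Tendsto (fun n => P {ω | |U n ω - c| < ε}) atTop (𝓝 1)

/-- `α = P(X = X')` for independent `X, X' ~ μ`. -/
def alphaR (μ : Measure ℝ) : ℝ :=
  ((μ.prod μ) {p : ℝ × ℝ | p.1 = p.2}).toReal

/-- The distribution `F̃` of `X` conditioned on `{X ≥ X'}`, for independent `X, X' ~ μ`. -/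
def tildeMeasure (μ : Measure ℝ) : Measure ℝ :=
  (ProbabilityTheory.cond (μ.prod μ) {p : ℝ × ℝ | p.2 ≤ p.1}).map Prod.fst

/-- `x_typ = E[Y]` with `Y ~ F̃`. -/
def xtyp (μ : Measure ℝ) : ℝ :=
  ∫ y, y ∂(tildeMeasure μ)

/-- For independent `X, X' ~ μ`, `P(X' ≤ X) = (1 + P(X = X')) / 2`. -/
theorem prod_real_snd_le_fst (μ : Measure ℝ) [IsProbabilityMeasure μ] :
    (μ.prod μ).real {p : ℝ × ℝ | p.2 ≤ p.1} = (1 + alphaR μ) / 2 := by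
  have hlt : MeasurableSet {p : ℝ × ℝ | p.1 < p.2} :=
    measurableSet_lt measurable_fst measurable_snd
  have hgt : MeasurableSet {p : ℝ × ℝ | p.2 < p.1} :=
    measurableSet_lt measurable_snd measurable_fst
  have hle : MeasurableSet {p : ℝ × ℝ | p.2 ≤ p.1} :=
    measurableSet_le measurable_snd measurable_fst
  have hswap : (μ.prod μ).real {p : ℝ × ℝ | p.2 < p.1}
      = (μ.prod μ).real {p : ℝ × ℝ | p.1 < p.2} := by
    conv_rhs => rw [← Measure.prod_swap (μ := μ) (ν := μ)]
    rw [map_measureReal_apply measurable_swap hlt]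
    rfl
  have hsplit : (μ.prod μ).real {p : ℝ × ℝ | p.2 ≤ p.1}
      = alphaR μ + (μ.prod μ).real {p : ℝ × ℝ | p.2 < p.1} := by
    have hunion : {p : ℝ × ℝ | p.2 ≤ p.1} = {p | p.1 = p.2} ∪ {p | p.2 < p.1} := by
      ext p
      simp only [mem_ofPred_eq, mem_union, le_iff_eq_or_lt, eq_comm]
    rw [hunion, measureReal_union _ hgt]
    · rfl
    · exact Set.disjoint_left.2 fun p hp hp' => ne_of_gt hp' hp
  have hcompl := probReal_compl_eq_one_sub (μ := μ.prod μ) hle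
  have hset : {p : ℝ × ℝ | p.2 ≤ p.1}ᶜ = {p | p.1 < p.2} := by
    ext p
    simp
  rw [hset] at hcompl
  linarith

/-- For independent `X, X' ~ μ`, `P(X < X' ≤ y)` is the integral of `x ↦ μ (Iio x)` over
`Iic y`. -/
theorem prod_real_fst_lt_snd_le (μ : Measure ℝ) [IsProbabilityMeasure μ] (y : ℝ) :
    (μ.prod μ).real {p : ℝ × ℝ | p.1 < p.2 ∧ p.2 ≤ y}
      = ∫ x in Iic y, (μ (Iio x)).toReal ∂μ := by
  have hmeas : MeasurableSet {p : ℝ × ℝ | p.1 < p.2 ∧ p.2 ≤ y} :=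
    (measurableSet_lt measurable_fst measurable_snd).inter
      (measurableSet_le measurable_snd measurable_const)
  have hmono : Monotone fun x : ℝ => μ (Iio x) :=
    fun a b h => measure_mono (Iio_subset_Iio h)
  rw [integral_toReal hmono.measurable.aemeasurable
    (Eventually.of_forall fun x => measure_lt_top μ _), measureReal_def,
    Measure.prod_apply_symm hmeas, ← lintegral_indicator measurableSet_Iic]
  congr 1
  refine lintegral_congr fun x => ?_
  by_cases hx : x ≤ y
  · rw [indicator_of_mem (mem_Iic.2 hx)]
    congr 1
    ext z
    simp [hx]
  · rw [indicator_of_notMem (by simpa using hx)]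
    simp [hx]

/-- Explicit formula for the conditional distribution function:
`F̃(y) = P(X ≤ y | X ≥ X') = (2/(1+α)) · [F(y)² − ∫_{(−∞,y]} F(x⁻) dF(x)]`,
where `F(y) = μ(-∞, y]`, `F(x⁻) = μ(-∞, x)`, and the integral is the
Lebesgue–Stieltjes integral with respect to `F`, i.e. the integral against `μ`
restricted to `(−∞, y]`. -/
theorem tilde_cdf_formula
    (μ : Measure ℝ) [IsProbabilityMeasure μ] (y : ℝ) :
    ((tildeMeasure μ) (Iic y)).toReal
      = (2 / (1 + alphaR μ)) *
        (((μ (Iic y)).toReal) ^ 2 - ∫ x in Iic y, (μ (Iio x)).toReal ∂μ) := by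
  have hle : MeasurableSet {p : ℝ × ℝ | p.2 ≤ p.1} :=
    measurableSet_le measurable_snd measurable_fst
  have hmeas : MeasurableSet {p : ℝ × ℝ | p.1 < p.2 ∧ p.2 ≤ y} :=
    (measurableSet_lt measurable_fst measurable_snd).inter
      (measurableSet_le measurable_snd measurable_const)
  have hsquare : (μ.prod μ).real ({p : ℝ × ℝ | p.2 ≤ p.1} ∩ Prod.fst ⁻¹' Iic y)
      + (μ.prod μ).real {p : ℝ × ℝ | p.1 < p.2 ∧ p.2 ≤ y} = μ.real (Iic y) ^ 2 := by
    rw [← measureReal_union _ hmeas, sq, ← measureReal_prod_prod]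
    · congr 1
      ext ⟨a, b⟩
      simp only [mem_union, mem_inter_iff, mem_ofPred_eq, mem_preimage, mem_Iic, mem_prod]
      grind
    · exact Set.disjoint_left.2 fun p hp hp' => not_lt_of_ge hp.1 hp'.1
  rw [prod_real_fst_lt_snd_le] at hsquare
  rw [tildeMeasure, Measure.map_apply measurable_fst measurableSet_Iic,
    cond_apply hle, ENNReal.toReal_mul, ENNReal.toReal_inv,
    ← measureReal_def, ← measureReal_def, prod_real_snd_le_fst, inv_div, ← measureReal_def,
    ← hsquare, add_sub_cancel_right]
end
end
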